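/- arXiv:1509.07594 — 5 statements merged into one kernel-verified Lean document; each statement's English description precedes it below -/
import Mathlib

section
/- Let U = {1,2,3} be a set of three users, B = {1,2,3} a set of three base stations, 𝒞 = {{1,2},{1,3},{2,3}} the family of all 2-element clusters of B, and capacity S j = 1 for every j ∈ B. Define x : U × 𝒞 → ℝ by x(1,{1,2}) = x(2,{1,3}) = x(3,{2,3}) = 1/2 and x(k,C) = 0 otherwise. Then x belongs to the activity-fraction polytope X, but x does not belong to the convex hull (over ℝ) of the set F of feasible scheduling instants. In particular, there exist activity fractions satisfying the resource-allocation constraints that cannot be implemented by any feasible schedule. -/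
open Finset

/-- The set of feasible scheduling instants: `e (k, C) ∈ {0,1}`, each user `k` is served by at
most one cluster of `𝒞`, and each BS `j` serves at most `S j` users over the clusters
containing `j`. -/
def schedF (U B : Type*) [Fintype U] [DecidableEq B]
    (𝒞 : Finset (Finset B)) (S : B → ℕ) : Set (U × Finset B → ℝ) :=
  {e | (∀ k C, e (k, C) = 0 ∨ e (k, C) = 1) ∧
    (∀ k : U, ∑ C ∈ 𝒞, e (k, C) ≤ 1) ∧
    (∀ j : B, ∑ C ∈ 𝒞.filter (fun C => j ∈ C), ∑ k : U, e (k, C) ≤ (S j : ℝ))}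

/-- The activity-fraction polytope: `x (k, C) ≥ 0`, each user's total activity fraction is at
most `1`, and each BS `j` allocates at most `S j` activity over the clusters containing `j`. -/
def schedX (U B : Type*) [Fintype U] [DecidableEq B]
    (𝒞 : Finset (Finset B)) (S : B → ℕ) : Set (U × Finset B → ℝ) :=
  {x | (∀ k C, 0 ≤ x (k, C)) ∧
    (∀ k : U, ∑ C ∈ 𝒞, x (k, C) ≤ 1) ∧
    (∀ j : B, ∑ C ∈ 𝒞.filter (fun C => j ∈ C), ∑ k : U, x (k, C) ≤ (S j : ℝ))}

/-- The family of all 2-element clusters of the three base stations `{0, 1, 2}`. -/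
def threeClusters : Finset (Finset (Fin 3)) := {{0, 1}, {0, 2}, {1, 2}}

/-- The activity fractions `x(0, {0,1}) = x(1, {0,2}) = x(2, {1,2}) = 1/2`, zero otherwise. -/
noncomputable def xHalf : Fin 3 × Finset (Fin 3) → ℝ := fun p =>
  if p = (0, ({0, 1} : Finset (Fin 3))) ∨ p = (1, ({0, 2} : Finset (Fin 3))) ∨
      p = (2, ({1, 2} : Finset (Fin 3))) then 1 / 2 else 0

theorem aux_filter0 : threeClusters.filter (fun C => (0 : Fin 3) ∈ C) = {{0, 1}, {0, 2}} := by decide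
theorem aux_filter1 : threeClusters.filter (fun C => (1 : Fin 3) ∈ C) = {{0, 1}, {1, 2}} := by decide
theorem aux_filter2 : threeClusters.filter (fun C => (2 : Fin 3) ∈ C) = {{0, 2}, {1, 2}} := by decide
theorem aux_ne1 : ({0, 1} : Finset (Fin 3)) ≠ {0, 2} := by decide
theorem aux_ne2 : ({0, 1} : Finset (Fin 3)) ≠ {1, 2} := by decide
theorem aux_ne3 : ({0, 2} : Finset (Fin 3)) ≠ {1, 2} := by decide

theorem aux_sum3 (f : Finset (Fin 3) → ℝ) :
    ∑ C ∈ threeClusters, f C = f {0, 1} + (f {0, 2} + f {1, 2}) := by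
  unfold threeClusters
  rw [Finset.sum_insert (by decide), Finset.sum_pair aux_ne3]

/-- with three users, three BSs, the three 2-element clusters, and unit
capacities, the activity fractions `xHalf` belong to the polytope `X` but not to the convex
hull of the set `F` of feasible scheduling instants: they cannot be implemented by any
feasible schedule. -/
theorem xHalf_mem_schedX_not_mem_convexHull_schedF :
    xHalf ∈ schedX (Fin 3) (Fin 3) threeClusters (fun _ => 1) ∧
    xHalf ∉ convexHull ℝ (schedF (Fin 3) (Fin 3) threeClusters (fun _ => 1)) := by
  constructor
  · refine ⟨?_, ?_, ?_⟩
    · intro k C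
      unfold xHalf
      split_ifs <;> norm_num
    · intro k
      rw [aux_sum3]
      fin_cases k <;>
        simp [xHalf, aux_ne1, aux_ne2, aux_ne3, aux_ne1.symm, aux_ne2.symm, aux_ne3.symm] <;>
        norm_num
    · intro j
      fin_cases j
      · change ∑ C ∈ threeClusters.filter (fun C => (0 : Fin 3) ∈ C), _ ≤ _
        rw [aux_filter0, Finset.sum_pair aux_ne1]
        simp [Fin.sum_univ_three, xHalf, aux_ne1, aux_ne2, aux_ne3, aux_ne1.symm, aux_ne2.symm,
          aux_ne3.symm]
        norm_num
      · change ∑ C ∈ threeClusters.filter (fun C => (1 : Fin 3) ∈ C), _ ≤ _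
        rw [aux_filter1, Finset.sum_pair aux_ne2]
        simp [Fin.sum_univ_three, xHalf, aux_ne1, aux_ne2, aux_ne3, aux_ne1.symm, aux_ne2.symm,
          aux_ne3.symm]
        norm_num
      · change ∑ C ∈ threeClusters.filter (fun C => (2 : Fin 3) ∈ C), _ ≤ _
        rw [aux_filter2, Finset.sum_pair aux_ne3]
        simp [Fin.sum_univ_three, xHalf, aux_ne1, aux_ne2, aux_ne3, aux_ne1.symm, aux_ne2.symm,
          aux_ne3.symm]
        norm_num
  · intro h
    have hsub : schedF (Fin 3) (Fin 3) threeClusters (fun _ => 1) ⊆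
        {e | e (0, {0, 1}) + e (1, {0, 2}) + e (2, {1, 2}) ≤ 1} := by
      rintro e ⟨h01, -, hB⟩
      have h0 := hB 0
      have h1 := hB 1
      have h2 := hB 2
      rw [aux_filter0, Finset.sum_pair aux_ne1] at h0
      rw [aux_filter1, Finset.sum_pair aux_ne2] at h1
      rw [aux_filter2, Finset.sum_pair aux_ne3] at h2
      simp only [Fin.sum_univ_three, Nat.cast_one] at h0 h1 h2
      have hn : ∀ k C, 0 ≤ e (k, C) := by
        intro k C
        rcases h01 k C with h | h <;> rw [h] <;> norm_num
      have a1 := hn 0 {0, 1}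
      have a2 := hn 1 {0, 1}
      have a3 := hn 2 {0, 1}
      have b1 := hn 0 {0, 2}
      have b2 := hn 1 {0, 2}
      have b3 := hn 2 {0, 2}
      have c1 := hn 0 {1, 2}
      have c2 := hn 1 {1, 2}
      have c3 := hn 2 {1, 2}
      show e (0, {0, 1}) + e (1, {0, 2}) + e (2, {1, 2}) ≤ 1
      rcases h01 0 {0, 1} with ha | ha <;> rcases h01 1 {0, 2} with hb | hb <;>
        rcases h01 2 {1, 2} with hc | hc <;> linarith
    have hconv : Convex ℝ {e : Fin 3 × Finset (Fin 3) → ℝ |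
        e (0, {0, 1}) + e (1, {0, 2}) + e (2, {1, 2}) ≤ 1} := by
      intro x hx y hy a b ha hb hab
      simp only [Set.mem_setOf_eq, Pi.add_apply, Pi.smul_apply, smul_eq_mul] at *
      nlinarith [mul_le_mul_of_nonneg_left hx ha, mul_le_mul_of_nonneg_left hy hb]
    have := convexHull_min hsub hconv h
    simp only [Set.mem_setOf_eq, xHalf, true_or, or_true, if_true] at this
    norm_num at this
end

section
/- Let ι be a finite nonempty index set, and let r : ι → ℝ and c : ι → ℝ satisfy r i > 0 and c i > 0 for all i. Let i₀ ∈ ι maximize the ratio i ↦ r i / c i, and define x* : ι → ℝ by x* i₀ = 1/(c i₀) and x* i = 0 for i ≠ i₀. Then for every x : ι → ℝ with x i ≥ 0 for all i and Σ_i x i · r i > 0, one has log(Σ_i x i · r i) − Σ_i c i · x i ≤ log(r i₀ / c i₀) − 1, and equality holds at x = x*. In particular, x* maximizes x ↦ log(Σ_i x i · r i) − Σ_i c i · x i over the nonnegative orthant (restricted to points where the logarithm is defined), and the maximal value equals log(r i₀ / c i₀) − 1. -/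
open Finset Real

/-- closed-form solution of the per-user Lagrangian subproblem. If `i₀`
maximizes the ratio `r i / c i` (with `r i, c i > 0`), then over all nonnegative `x`
with `∑ i, x i * r i > 0`, the objective `log (∑ i, x i * r i) - ∑ i, c i * x i` is at most
`log (r i₀ / c i₀) - 1`, and this value is attained at the point `x*` that puts mass
`1 / c i₀` on `i₀` and `0` elsewhere. -/
theorem lagrangian_subproblem_closed_form
    {ι : Type*} [Fintype ι] [Nonempty ι] [DecidableEq ι]
    (r c : ι → ℝ) (hr : ∀ i, 0 < r i) (hc : ∀ i, 0 < c i)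
    (i₀ : ι) (hi₀ : ∀ i, r i / c i ≤ r i₀ / c i₀) :
    (∀ x : ι → ℝ, (∀ i, 0 ≤ x i) → 0 < ∑ i, x i * r i →
      Real.log (∑ i, x i * r i) - ∑ i, c i * x i ≤ Real.log (r i₀ / c i₀) - 1) ∧
    Real.log (∑ i, (fun i => if i = i₀ then 1 / c i₀ else 0) i * r i) -
        ∑ i, c i * (fun i => if i = i₀ then 1 / c i₀ else 0) i =
      Real.log (r i₀ / c i₀) - 1 := by
  have hρ : 0 < r i₀ / c i₀ := div_pos (hr i₀) (hc i₀)
  refine ⟨fun x hx hS => ?_, ?_⟩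
  · have h1 : ∑ i, x i * r i ≤ (r i₀ / c i₀) * ∑ i, c i * x i := by
      rw [Finset.mul_sum]
      refine Finset.sum_le_sum fun i _ => ?_
      have h := (div_le_iff₀ (hc i)).1 (hi₀ i)
      calc x i * r i ≤ x i * (r i₀ / c i₀ * c i) := mul_le_mul_of_nonneg_left h (hx i)
        _ = _ := by ring
    have h2 := Real.log_le_sub_one_of_pos (div_pos hS hρ)
    rw [Real.log_div hS.ne' hρ.ne'] at h2
    have h3 : (∑ i, x i * r i) / (r i₀ / c i₀) ≤ ∑ i, c i * x i := by
      rw [div_le_iff₀ hρ]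
      linarith
    linarith
  · have h0 := (hc i₀).ne'
    have e1 : ∑ i, (fun i => if i = i₀ then 1 / c i₀ else 0) i * r i = r i₀ / c i₀ := by
      simp [ite_mul]
      ring
    have e2 : ∑ i, c i * (fun i => if i = i₀ then 1 / c i₀ else 0) i = 1 := by
      simp [mul_ite, h0]
    rw [e1, e2]
end

section
/- Let K be a finite nonempty index set and P ⊆ ℝ^K a convex set of achievable rate vectors all of whose elements have strictly positive coordinates, and let R* ∈ P be log-optimal. Then for every R ∈ P, min_{k∈K} R_k / R*_k ≤ 1. -/
open Finset

/-- if `R*` is log-optimal over a convex set `P` of strictly positive rate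
vectors, then for every `R ∈ P`, `min_k (R k / R* k) ≤ 1`. -/
theorem min_ratio_le_one_of_log_optimal
    {K : Type*} [Fintype K] [Nonempty K]
    (P : Set (K → ℝ)) (hP : Convex ℝ P) (hpos : ∀ R ∈ P, ∀ k, 0 < R k)
    (Rstar : K → ℝ) (hRstar : Rstar ∈ P)
    (hopt : ∀ Q ∈ P, ∑ k, Real.log (Q k) ≤ ∑ k, Real.log (Rstar k)) :
    ∀ R ∈ P, univ.inf' univ_nonempty (fun k => R k / Rstar k) ≤ 1 := by
  intro R hR
  by_contra! h
  rw [Finset.lt_inf'_iff] at h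
  have hlt : ∑ k, Real.log (Rstar k) < ∑ k, Real.log (R k) := by
    apply Finset.sum_lt_sum_of_nonempty univ_nonempty
    intro k hk
    have hs := hpos Rstar hRstar k
    exact Real.log_lt_log hs ((one_lt_div hs).mp (h k hk))
  exact absurd (hopt R hR) (not_le.mpr hlt)
end

section
/- Let K be a finite nonempty index set and P ⊆ ℝ^K a convex set of achievable rate vectors all of whose elements have strictly positive coordinates, and let R* ∈ P be log-optimal. Then the maximum of the map R ↦ min_{k∈K} R_k / R*_k over P equals 1, it is attained at R*, and every R ∈ P with min_{k∈K} R_k / R*_k ≥ 1 satisfies R = R*. Consequently, every maximizer of R ↦ min_{k∈K} R_k / R*_k over P equals the log-optimal point R*. -/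
open Finset

/-- if `R*` is log-optimal over a convex set `P` of strictly positive rate
vectors, then the max–min objective `R ↦ min_k (R k / R* k)` attains the value `1` at `R*`,
is at most `1` on all of `P`, every `R ∈ P` with `min_k (R k / R* k) ≥ 1` equals `R*`, and
consequently every maximizer of the max–min objective over `P` equals `R*`. -/
theorem max_min_ratio_recovers_log_optimal
    {K : Type*} [Fintype K] [Nonempty K]
    (P : Set (K → ℝ)) (hP : Convex ℝ P) (hpos : ∀ R ∈ P, ∀ k, 0 < R k)
    (Rstar : K → ℝ) (hRstar : Rstar ∈ P)
    (hopt : ∀ Q ∈ P, ∑ k, Real.log (Q k) ≤ ∑ k, Real.log (Rstar k)) :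
    (univ.inf' univ_nonempty (fun k => Rstar k / Rstar k) = 1) ∧
    (∀ R ∈ P, univ.inf' univ_nonempty (fun k => R k / Rstar k) ≤ 1) ∧
    (∀ R ∈ P, 1 ≤ univ.inf' univ_nonempty (fun k => R k / Rstar k) → R = Rstar) ∧
    (∀ R ∈ P,
      (∀ Q ∈ P, univ.inf' univ_nonempty (fun k => Q k / Rstar k) ≤
        univ.inf' univ_nonempty (fun k => R k / Rstar k)) → R = Rstar) := by
  have h1 : univ.inf' univ_nonempty (fun k => Rstar k / Rstar k) = 1 := by
    have h : (fun k => Rstar k / Rstar k) = fun _ => (1 : ℝ) := by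
      funext k
      exact div_self (hpos Rstar hRstar k).ne'
    rw [h]
    exact Finset.inf'_const _ _
  have h3 : ∀ R ∈ P, 1 ≤ univ.inf' univ_nonempty (fun k => R k / Rstar k) → R = Rstar := by
    intro R hR h
    have hle : ∀ k, Rstar k ≤ R k := by
      intro k
      have hk := (Finset.le_inf'_iff _ _).1 h k (mem_univ k)
      exact (one_le_div (hpos Rstar hRstar k)).1 hk
    have hlog : ∀ k ∈ (univ : Finset K), Real.log (Rstar k) ≤ Real.log (R k) := fun k _ =>
      Real.log_le_log (hpos Rstar hRstar k) (hle k)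
    have heq := (Finset.sum_eq_sum_iff_of_le hlog).1
      (le_antisymm (Finset.sum_le_sum hlog) (hopt R hR))
    funext k
    exact (Real.log_injOn_pos (hpos Rstar hRstar k) (hpos R hR k) (heq k (mem_univ k))).symm
  refine ⟨h1, ?_, h3, ?_⟩
  · intro R hR
    by_contra hc
    have hc' := not_le.1 hc
    have h := h3 R hR hc'.le
    subst h
    exact hc h1.le
  · intro R hR h
    exact h3 R hR (h1 ▸ h Rstar hRstar)
end

section
/- Let n be a finite index type and F a finite set of vectors in ℝ^n. For every x in the convex hull (over ℝ) of F, there exists a sequence e : ℕ → ℝ^n with e t ∈ F for all t such that the time averages (1/T) · Σ_{t < T} e t converge to x as T → ∞. That is, any point of the convex hull of the feasible scheduling instants can be achieved in the long term by time sharing among feasible scheduling instants. -/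
open Finset Filter

/-- any point of the convex hull of a finite set `F` of vectors in `ℝ^n` can be
achieved in the long term by time sharing: there is a sequence of elements of `F` whose time
averages converge to the point. -/
theorem convexHull_mem_achievable_by_time_sharing
    {n : Type*} [Fintype n]
    (F : Finset (n → ℝ)) (x : n → ℝ) (hx : x ∈ convexHull ℝ (F : Set (n → ℝ))) :
    ∃ e : ℕ → (n → ℝ), (∀ t, e t ∈ F) ∧
      Tendsto (fun T : ℕ => (1 / (T : ℝ)) • ∑ t ∈ Finset.range T, e t)
        atTop (nhds x) := by
  have key : ∀ d : n → ℝ, ∃ f ∈ F, d ⬝ᵥ (f - x) ≤ 0 := by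
    intro d
    by_contra! h
    have hc : Convex ℝ {y : n → ℝ | d ⬝ᵥ x < d ⬝ᵥ y} := by
      apply convex_halfSpace_gt
      exact ⟨fun a b => dotProduct_add d a b, fun c a => dotProduct_smul c d a⟩
    have hs : (F : Set (n → ℝ)) ⊆ {y : n → ℝ | d ⬝ᵥ x < d ⬝ᵥ y} := by
      intro f hf
      have := h f hf
      rw [dotProduct_sub] at this
      simpa using this
    exact lt_irrefl (d ⬝ᵥ x) (convexHull_min hs hc hx)
  choose c hcF hc using key
  let D : ℕ → (n → ℝ) := fun k => Nat.rec 0 (fun _ d => d + (c d - x)) k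
  have D0 : D 0 = 0 := rfl
  have DS : ∀ k, D (k+1) = D k + (c (D k) - x) := fun k => rfl
  set C : ℝ := ∑ f ∈ F, (f - x) ⬝ᵥ (f - x) with hCdef
  have nn : ∀ v : n → ℝ, 0 ≤ v ⬝ᵥ v := fun v => Finset.sum_nonneg fun i _ => mul_self_nonneg _
  have hC : ∀ f ∈ F, (f - x) ⬝ᵥ (f - x) ≤ C := fun f hf =>
    Finset.single_le_sum (f := fun f => (f - x) ⬝ᵥ (f - x)) (fun g _ => nn _) hf
  have hD : ∀ T : ℕ, D T ⬝ᵥ D T ≤ C * T := by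
    intro T
    induction T with
    | zero => simp [D0]
    | succ k ih =>
      rw [DS, add_dotProduct, dotProduct_add, dotProduct_add, dotProduct_comm (c (D k) - x) (D k)]
      have h1 := hc (D k)
      have h2 := hC _ (hcF (D k))
      push_cast
      linarith
  have hsum : ∀ T : ℕ, ∑ t ∈ Finset.range T, c (D t) = D T + (T : ℝ) • x := by
    intro T
    induction T with
    | zero => simp [D0]
    | succ k ih =>
      rw [Finset.sum_range_succ, ih, DS]
      push_cast
      rw [add_smul, one_smul]
      abel
  refine ⟨fun t => c (D t), fun t => hcF _, ?_⟩
  rw [tendsto_pi_nhds]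
  intro i
  rw [tendsto_iff_norm_sub_tendsto_zero]
  have hlim : Tendsto (fun T : ℕ => Real.sqrt (C / (T : ℝ))) atTop (nhds 0) := by
    have := (Real.continuous_sqrt.tendsto 0).comp (tendsto_const_div_atTop_nhds_zero_nat C)
    rw [Real.sqrt_zero] at this
    exact this
  refine squeeze_zero' (Eventually.of_forall fun _ => norm_nonneg _) ?_ hlim
  filter_upwards [eventually_gt_atTop 0] with T hT
  have hT' : (0 : ℝ) < T := by exact_mod_cast hT
  have e1 : ((1 / (T : ℝ)) • ∑ t ∈ Finset.range T, c (D t)) i - x i = D T i / T := by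
    rw [hsum]
    simp only [Pi.smul_apply, Pi.add_apply, smul_eq_mul]
    field_simp
    ring
  rw [e1, Real.norm_eq_abs]
  apply Real.abs_le_sqrt
  have h3 : D T i * D T i ≤ D T ⬝ᵥ D T :=
    Finset.single_le_sum (f := fun j => D T j * D T j) (fun j _ => mul_self_nonneg _)
      (Finset.mem_univ i)
  have h4 := hD T
  rw [div_pow, div_le_div_iff₀ (by positivity) hT']
  nlinarith
end
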